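/- Let x, z ∈ P, let ψ : *E_x → *E_z be a nonzero clean map, and let α be a basis monomial of *E_x. Then the coefficient of 1_z in ψ(α) (with respect to the monomial basis of *E_z) is nonzero if and only if α = 1_x. -/

import Mathlib

open scoped Classical
open MvPolynomial

noncomputable section

variable (K : Type) [Field K]
variable (P : Type) [Fintype P] [PartialOrder P] [OrderBot P]

/-- A finite poset with a least element is *simplicial* if every lower interval
is isomorphic to a boolean algebra (the lattice of all subsets of a finite set). -/
def IsSimplicialPoset : Prop :=
  ∀ x : P, ∃ m : ℕ, Nonempty (Set.Iic x ≃o Finset (Fin m))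

/-- `P* := P \ {0̂}`. -/
abbrev Pstar := {z : P // z ≠ ⊥}

/-- The polynomial ring `S = K[t_z : z ∈ P*]`. -/
abbrev FaceS := MvPolynomial (Pstar P) K

/-- The variable `t_z`, with the convention `t_{0̂} = 1`. -/
def tvar (z : P) : FaceS K P := if h : z = ⊥ then 1 else X ⟨z, h⟩

/-- The set `[a ∨ b]` of minimal elements of the common upper bounds of `a` and `b`. -/
def minUB (a b : P) : Set P :=
  {z | a ≤ z ∧ b ≤ z ∧ ∀ w, a ≤ w → b ≤ w → ¬ w < z}

/-- Minimal elements of the common upper bounds of a set `A`. -/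
def minUBset (A : Set P) : Set P :=
  {z | (∀ a ∈ A, a ≤ z) ∧ ∀ w, (∀ a ∈ A, a ≤ w) → ¬ w < z}

/-- The meet `a ∧ b`, i.e. the largest common lower bound, when it exists (`⊥` otherwise). -/
def pmeet (a b : P) : P :=
  if h : ∃ m, m ≤ a ∧ m ≤ b ∧ ∀ w, w ≤ a → w ≤ b → w ≤ m then h.choose else ⊥

/-- The generator `f_{a,b} = t_a t_b - t_{a ∧ b} ∑_{z ∈ [a ∨ b]} t_z` of the face ideal. -/
def fgen (a b : Pstar P) : FaceS K P :=
  X a * X b - tvar K P (pmeet P a.1 b.1) *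
    ∑ z ∈ (Set.toFinite (minUB P a.1 b.1)).toFinset, tvar K P z

/-- The face ideal `I_P`. -/
def faceIdeal : Ideal (FaceS K P) :=
  Ideal.span (Set.range fun p : Pstar P × Pstar P => fgen K P p.1 p.2)

variable (n : ℕ) (y : Fin n → P)

/-- `y` is an enumeration of the rank one elements (= atoms) of `P`. -/
def AtomEnum : Prop :=
  Function.Injective y ∧ ∀ p : P, IsAtom p ↔ ∃ i, y i = p

/-- The rank of an element: the number of atoms below it. -/
def prank (z : P) : ℕ := (Finset.univ.filter fun i : Fin n => y i ≤ z).card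

/-- The `ℤⁿ`-degree of the variable `t_z`: `deg t_z = ∑_{y_i ≤ z} e_i`. -/
def tdeg (z : Pstar P) : Fin n → ℤ := fun i => if y i ≤ z.1 then 1 else 0

/-- `w = ∑_{z ∈ P*} deg t_z`. -/
def wvec : Fin n → ℤ := fun i => ∑ z : Pstar P, tdeg P n y z i

/-- The degree `d` homogeneous component of `S` for the `ℤⁿ`-grading. -/
def Sgrade (d : Fin n → ℤ) : AddSubgroup (FaceS K P) :=
  (weightedHomogeneousSubmodule K (tdeg P n y) d).toAddSubgroup

/-- The transformed variable `t̃_z` (relative to `x`), with `t̃_{0̂} = 1`. -/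
def ttil (x z : P) : FaceS K P :=
  if z ≤ x ∧ 2 ≤ prank P n y z then
    tvar K P z - ∏ i ∈ Finset.univ.filter fun i : Fin n => y i ≤ z, tvar K P (y i)
  else tvar K P z

/-- The graded prime ideal `p_x = (t_z : z ≰ x) + I_P`. -/
def pIdeal (x : P) : Ideal (FaceS K P) :=
  Ideal.span ((fun z : Pstar P => (X z : FaceS K P)) '' {z | ¬ z.1 ≤ x}) ⊔ faceIdeal K P

/-- The indices of the atoms below `x`. -/
abbrev BelowIx (x : P) := {i : Fin n // y i ≤ x}

/-- `P*_{-x}`: the elements of `P*` which are not atoms below `x`. -/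
abbrev Pmx (x : P) := {z : P // z ≠ ⊥ ∧ ¬ ∃ i : Fin n, y i ≤ x ∧ y i = z}

/-- Index monoid for the "big Laurent" model of `*E_x`. -/
abbrev EIdx (x : P) := (BelowIx P n y x →₀ ℤ) × (Pmx P n y x →₀ ℤ)

/-- The "big Laurent" algebra `K[t_i^{±1} : y_i ≤ x] ⊗_K K[t̃_z^{±1} : z ∈ P*_{-x}]`. -/
abbrev Gx (x : P) := AddMonoidAlgebra K (EIdx P n y x)

/-- Exponent vector of `π_x(t_z) = ∏_{y_i ≤ z} t_i`. -/
def dvec (x : P) (z : P) : BelowIx P n y x →₀ ℤ :=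
  Finsupp.equivFunOnFinite.symm fun i => if y i.1 ≤ z then 1 else 0

/-- The action of `S` on the big Laurent algebra through the comultiplication
`Δ(t_z) = t_z ⊗ 1 + 1 ⊗ t_z`:  the variable `t_z` acts as `π_x(t_z) ⊗ 1 + 1 ⊗ t_z`. -/
def theta (x : P) : FaceS K P →ₐ[K] Gx K P n y x :=
  aeval fun z : Pstar P =>
    (if z.1 ≤ x then AddMonoidAlgebra.single (dvec P n y x z.1, 0) 1 else 0) +
    (if h : ∃ i : Fin n, y i ≤ x ∧ y i = z.1 then 0
     else AddMonoidAlgebra.single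
       ((0 : BelowIx P n y x →₀ ℤ), Finsupp.single (⟨z.1, z.2, h⟩ : Pmx P n y x) (1 : ℤ)) 1)

instance gxModule (x : P) : Module (FaceS K P) (Gx K P n y x) :=
  Module.compHom _ (theta K P n y x).toRingHom

instance gxTower (x : P) : IsScalarTower K (FaceS K P) (Gx K P n y x) := by
  refine ⟨fun k s g => ?_⟩
  show theta K P n y x (k • s) * g = k • (theta K P n y x s * g)
  rw [map_smul, smul_mul_assoc]

instance gxComm (x : P) : SMulCommClass (FaceS K P) K (Gx K P n y x) := by
  refine ⟨fun s k g => ?_⟩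
  show theta K P n y x s * (k • g) = k • (theta K P n y x s * g)
  exact mul_smul_comm k _ g

/-- The submodule by which we quotient the big Laurent algebra to obtain `*E_x`. -/
def Ux (x : P) : Submodule (FaceS K P) (Gx K P n y x) :=
  Submodule.span (FaceS K P)
    {g | ∃ p : EIdx P n y x, (∃ w, 0 < p.2 w) ∧ g = AddMonoidAlgebra.single p 1}

/-- The `ℤⁿ`-graded `S`-module `*E_x = K[t_i^{±1} : y_i ≤ x] ⊗_K K[t_z^{-1} : z ∈ P*_{-x}]`. -/
abbrev ExMod (x : P) := Gx K P n y x ⧸ Ux K P n y x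

instance exComm (x : P) : SMulCommClass (FaceS K P) K (ExMod K P n y x) := by
  refine ⟨fun s k e => ?_⟩
  obtain ⟨g, rfl⟩ := Submodule.Quotient.mk_surjective _ e
  simp only [← Submodule.Quotient.mk_smul]
  rw [smul_comm]

def mIdx (x : P) (a : BelowIx P n y x →₀ ℤ) (b : Pmx P n y x →₀ ℕ) : EIdx P n y x :=
  (a, -Finsupp.mapRange (Nat.cast : ℕ → ℤ) Nat.cast_zero b)

/-- The monomial `∏ t_i^{a_i} ⊗ ∏ t_z^{-b_z}` of `*E_x`. -/
def emono (x : P) (a : BelowIx P n y x →₀ ℤ) (b : Pmx P n y x →₀ ℕ) : ExMod K P n y x :=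
  Submodule.Quotient.mk (AddMonoidAlgebra.single (mIdx P n y x a b) 1)

/-- `1_x = 1 ⊗ 1 ∈ *E_x`. -/
def onex (x : P) : ExMod K P n y x := emono K P n y x 0 0

/-- The `ℤⁿ`-degree of the monomial of `*E_x` with index `p`. -/
def gdeg (x : P) (p : EIdx P n y x) : Fin n → ℤ := fun i =>
  (if h : y i ≤ x then p.1 ⟨i, h⟩ else 0) +
    p.2.sum fun w c => c * (if y i ≤ w.1 then 1 else 0)

/-- The degree `aa` homogeneous component of `*E_x`. -/
def ExGrade (x : P) (aa : Fin n → ℤ) : Submodule K (ExMod K P n y x) :=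
  Submodule.span K
    {e | ∃ p : EIdx P n y x, gdeg P n y x p = aa ∧
      e = Submodule.Quotient.mk (AddMonoidAlgebra.single p 1)}

/-- `L(*E_x)`: the span of the basis monomials with nontrivial second factor and
componentwise nonnegative `ℤⁿ`-degree. -/
def cleanL (x : P) : Submodule K (ExMod K P n y x) :=
  Submodule.span K
    {e | ∃ a b, b ≠ 0 ∧ (∀ i, 0 ≤ gdeg P n y x (mIdx P n y x a b) i) ∧
      e = emono K P n y x a b}

/-- Degree preserving homomorphisms `*E_x → *E_z` (elements of `[*Hom(E_x, E_z)]_0`). -/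
def DegZero (x z : P) (φ : ExMod K P n y x →ₗ[FaceS K P] ExMod K P n y z) : Prop :=
  ∀ aa, ∀ e ∈ ExGrade K P n y x aa, φ e ∈ ExGrade K P n y z aa

/-- Clean homomorphisms `*E_x → *E_z`. -/
def IsClean (x z : P) (φ : ExMod K P n y x →ₗ[FaceS K P] ExMod K P n y z) : Prop :=
  DegZero K P n y x z φ ∧ ∀ e ∈ cleanL K P n y x, φ e ∈ cleanL K P n y z

set_option linter.unusedSectionVars false

theorem gx_smul_def (x : P) (s : FaceS K P) (g : Gx K P n y x) :
    s • g = theta K P n y x s * g := rfl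

section Helpers

variable {P n y}

theorem AtomEnum.ne_bot (hy : AtomEnum P n y) (i : Fin n) : y i ≠ ⊥ :=
  ((hy.2 _).2 ⟨i, rfl⟩).1

theorem AtomEnum.le_iff (hy : AtomEnum P n y) (i j : Fin n) : y i ≤ y j ↔ i = j := by
  refine ⟨fun h => hy.1 ?_, fun h => h ▸ le_rfl⟩
  exact (((hy.2 _).2 ⟨j, rfl⟩).le_iff.1 h).resolve_left (hy.ne_bot i)

theorem theta_tvar_of_le (hy : AtomEnum P n y) {x : P} {i : Fin n} (h : y i ≤ x) :
    theta K P n y x (tvar K P (y i)) =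
      AddMonoidAlgebra.single (Finsupp.single ⟨i, h⟩ 1, 0) 1 := by
  have hd : dvec P n y x (y i) = Finsupp.single ⟨i, h⟩ 1 := by
    ext j
    simp [dvec, hy.le_iff, Finsupp.single_apply, Subtype.ext_iff, eq_comm]
  have hex : ∃ j : Fin n, y j ≤ x ∧ y j = y i := ⟨i, h, rfl⟩
  simp only [tvar, hy.ne_bot i, dite_false, theta, aeval_X, h, if_true, hd, hex, dite_true,
    add_zero]

theorem exists_theta_tvar_of_not_le (hy : AtomEnum P n y) {x : P} {i : Fin n} (h : ¬ y i ≤ x) :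
    ∃ w : Pmx P n y x, theta K P n y x (tvar K P (y i)) =
      AddMonoidAlgebra.single (0, Finsupp.single w 1) 1 := by
  have hex : ¬ ∃ j : Fin n, y j ≤ x ∧ y j = y i := fun ⟨j, hj, e⟩ => h (e ▸ hj)
  refine ⟨⟨y i, hy.ne_bot i, hex⟩, ?_⟩
  simp only [tvar, hy.ne_bot i, dite_false, theta, aeval_X, h, if_false, hex, zero_add]

/-- The monomial `∏ t_i^{a_i}` in the variables attached to the atoms below `z`. -/
def atomMon {z : P} (a : BelowIx P n y z →₀ ℕ) : FaceS K P :=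
  a.prod fun i k => tvar K P (y i.1) ^ k

theorem atomMon_single {z : P} (i : BelowIx P n y z) (k : ℕ) :
    atomMon K (Finsupp.single i k) = tvar K P (y i.1) ^ k := by
  simp [atomMon]

theorem atomMon_add {z : P} (a a' : BelowIx P n y z →₀ ℕ) :
    atomMon K (a + a') = atomMon K a * atomMon K a' :=
  Finsupp.prod_add_index' (fun _ => pow_zero _) fun _ _ _ => pow_add _ _ _

theorem theta_atomMon (hy : AtomEnum P n y) {z : P} (a : BelowIx P n y z →₀ ℕ) :
    theta K P n y z (atomMon K a) =
      AddMonoidAlgebra.single (a.mapRange (Nat.cast : ℕ → ℤ) Nat.cast_zero, 0) 1 := by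
  induction a using Finsupp.induction_linear with
  | zero => rw [atomMon, Finsupp.prod_zero_index, map_one, Finsupp.mapRange_zero, Prod.mk_zero_zero,
      AddMonoidAlgebra.one_def]
  | add f g hf hg =>
    rw [atomMon_add, map_mul, hf, hg, AddMonoidAlgebra.single_mul_single,
      Finsupp.mapRange_add Nat.cast_add]
    simp
  | single i k =>
    rw [atomMon_single, map_pow, theta_tvar_of_le K hy i.2, AddMonoidAlgebra.single_pow]
    simp [Prod.smul_mk]

theorem isUnit_theta_atomMon (hy : AtomEnum P n y) {x z : P} (h : ∀ i, y i ≤ z → y i ≤ x)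
    (a : BelowIx P n y z →₀ ℕ) : IsUnit (theta K P n y x (atomMon K a)) := by
  induction a using Finsupp.induction_linear with
  | zero => simp [atomMon]
  | add f g hf hg => rw [atomMon_add, map_mul]; exact hf.mul hg
  | single i k =>
    rw [atomMon_single, map_pow, theta_tvar_of_le K hy (h _ i.2)]
    refine IsUnit.pow k (IsUnit.of_mul_eq_one
      (AddMonoidAlgebra.single (-(Finsupp.single ⟨i.1, h _ i.2⟩ 1), 0) 1) ?_)
    simp [AddMonoidAlgebra.one_def, ← Prod.mk_zero_zero]

theorem exists_theta_eq_single (hy : AtomEnum P n y) {z : P} (b : Pmx P n y z →₀ ℕ) :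
    ∃ s, theta K P n y z s =
      AddMonoidAlgebra.single (0, b.mapRange (Nat.cast : ℕ → ℤ) Nat.cast_zero) 1 := by
  induction b using Finsupp.induction_linear with
  | zero => exact ⟨1, by rw [map_one, Finsupp.mapRange_zero, Prod.mk_zero_zero, AddMonoidAlgebra.one_def]⟩
  | add f g hf hg =>
    obtain ⟨s, hs⟩ := hf
    obtain ⟨t, ht⟩ := hg
    refine ⟨s * t, ?_⟩
    rw [map_mul, hs, ht, AddMonoidAlgebra.single_mul_single, Finsupp.mapRange_add Nat.cast_add]
    simp
  | single w k =>
    let d : BelowIx P n y z →₀ ℕ :=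
      Finsupp.equivFunOnFinite.symm fun i => if y i.1 ≤ w.1 then 1 else 0
    have hd : d.mapRange (Nat.cast : ℕ → ℤ) Nat.cast_zero = dvec P n y z w.1 := by
      ext i
      simp [d, dvec]
    refine ⟨(X ⟨w.1, w.2.1⟩ - if w.1 ≤ z then atomMon K d else 0) ^ k, ?_⟩
    have hX : theta K P n y z (X ⟨w.1, w.2.1⟩) =
        (if w.1 ≤ z then AddMonoidAlgebra.single (dvec P n y z w.1, 0) 1 else 0) +
          AddMonoidAlgebra.single (0, Finsupp.single w 1) 1 := by
      simp only [theta, aeval_X, w.2.2, dite_false]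
    have hA : theta K P n y z (if w.1 ≤ z then atomMon K d else 0) =
        if w.1 ≤ z then AddMonoidAlgebra.single (dvec P n y z w.1, 0) 1 else 0 := by
      split_ifs
      · rw [theta_atomMon K hy, hd]
      · exact map_zero _
    rw [map_pow, map_sub, hX, hA, add_sub_cancel_left, AddMonoidAlgebra.single_pow]
    simp [Prod.smul_mk]

/-- The elements of the Laurent algebra supported on exponents with a positive entry in the second
factor are stable under multiplication by the image of `theta`. -/
theorem theta_mul_coeff_eq_zero {x : P} (s : FaceS K P) (g : Gx K P n y x)
    (hg : ∀ p : EIdx P n y x, p.2 ≤ 0 → g.coeff p = 0) :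
    ∀ p : EIdx P n y x, p.2 ≤ 0 → (theta K P n y x s * g).coeff p = 0 := by
  have key : ∀ (q : EIdx P n y x), 0 ≤ q.2 → ∀ g : Gx K P n y x,
      (∀ p : EIdx P n y x, p.2 ≤ 0 → g.coeff p = 0) →
      ∀ p : EIdx P n y x, p.2 ≤ 0 → (AddMonoidAlgebra.single q 1 * g).coeff p = 0 := by
    intro q hq g hg p hp
    rw [AddMonoidAlgebra.coeff_single_mul_apply, one_mul]
    exact hg _ (by simpa using hp.trans hq)
  induction s using MvPolynomial.induction_on generalizing g with
  | C r =>
    intro p hp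
    rw [theta, aeval_C, Algebra.algebraMap_eq_smul_one, smul_mul_assoc, one_mul,
      AddMonoidAlgebra.coeff_smul_apply, hg p hp, smul_zero]
  | add s t hs ht =>
    intro p hp
    rw [map_add, add_mul, AddMonoidAlgebra.coeff_add, Finsupp.add_apply, hs g hg p hp,
      ht g hg p hp, add_zero]
  | mul_X s w hs =>
    rw [map_mul, mul_assoc]
    refine hs _ fun p hp => ?_
    rw [theta, aeval_X, add_mul, AddMonoidAlgebra.coeff_add, Finsupp.add_apply]
    split_ifs
    · rw [zero_mul, key _ le_rfl g hg p hp]; simp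
    · rw [key _ le_rfl g hg p hp, key _ (by simp) g hg p hp, add_zero]
    · simp
    · rw [zero_mul, key _ (by simp) g hg p hp]; simp

theorem mem_Ux_iff {x : P} (g : Gx K P n y x) :
    g ∈ Ux K P n y x ↔ ∀ p : EIdx P n y x, p.2 ≤ 0 → g.coeff p = 0 := by
  constructor
  · intro hg
    induction hg using Submodule.span_induction with
    | mem g h =>
      obtain ⟨q, ⟨w, hw⟩, rfl⟩ := h
      intro p hp
      rw [AddMonoidAlgebra.coeff_single, Finsupp.single_apply, if_neg]
      rintro rfl
      exact absurd (hp w) (not_le.2 hw)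
    | zero => simp
    | add g g' _ _ hg hg' =>
      intro p hp
      rw [AddMonoidAlgebra.coeff_add, Finsupp.add_apply, hg p hp, hg' p hp, add_zero]
    | smul s g _ hg => exact theta_mul_coeff_eq_zero K s g hg
  · intro h
    rw [← AddMonoidAlgebra.sum_coeff_single g]
    refine Submodule.sum_mem _ fun p hp => ?_
    have hp2 : ∃ w, 0 < p.2 w := by
      by_contra! hc
      exact Finsupp.mem_support_iff.1 hp (h p hc)
    have : (AddMonoidAlgebra.single p (g.coeff p) : Gx K P n y x) =
        g.coeff p • AddMonoidAlgebra.single p 1 := by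
      simp
    rw [this]
    exact Submodule.smul_of_tower_mem _ _ (Submodule.subset_span ⟨p, hp2, rfl⟩)

/-- The functional reading off the coefficient of a basis monomial of `*E_x`. -/
def exCoeff {x : P} (p : EIdx P n y x) (hp : p.2 ≤ 0) : ExMod K P n y x →ₗ[K] K :=
  (((Ux K P n y x).restrictScalars K).liftQ
    { toFun := fun g => g.coeff p
      map_add' := fun _ _ => rfl
      map_smul' := fun _ _ => rfl }
    fun g hg => (mem_Ux_iff K g).1 hg p hp) ∘ₗ
  (Submodule.Quotient.restrictScalarsEquiv K (Ux K P n y x)).symm.toLinearMap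

theorem exCoeff_mk {x : P} (p : EIdx P n y x) (hp : p.2 ≤ 0) (g : Gx K P n y x) :
    exCoeff K p hp (Submodule.Quotient.mk g) = g.coeff p := rfl

theorem exists_exCoeff_ne_zero {x : P} {e : ExMod K P n y x} (he : e ≠ 0) :
    ∃ p hp, exCoeff K p hp e ≠ 0 := by
  obtain ⟨g, rfl⟩ := Submodule.Quotient.mk_surjective _ e
  rw [Ne, Submodule.Quotient.mk_eq_zero, mem_Ux_iff] at he
  push Not at he
  obtain ⟨p, hp, hc⟩ := he
  exact ⟨p, hp, hc⟩

theorem exCoeff_smul {x : P} {s : FaceS K P} {q : EIdx P n y x}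
    (hs : theta K P n y x s = AddMonoidAlgebra.single q 1) (p : EIdx P n y x) (hp : p.2 ≤ 0)
    (hpq : (p - q).2 ≤ 0) (e : ExMod K P n y x) :
    exCoeff K p hp (s • e) = exCoeff K (p - q) hpq e := by
  obtain ⟨g, rfl⟩ := Submodule.Quotient.mk_surjective _ e
  rw [← Submodule.Quotient.mk_smul, exCoeff_mk, exCoeff_mk, gx_smul_def, hs,
    AddMonoidAlgebra.coeff_single_mul_apply, one_mul, neg_add_eq_sub]

theorem exCoeff_eq_zero_of_mem_span {x : P} {e : ExMod K P n y x}
    (he : e ∈ Submodule.span K {e : ExMod K P n y x | ∃ p : EIdx P n y x,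
      p ≠ (0, 0) ∧ e = Submodule.Quotient.mk (AddMonoidAlgebra.single p 1)}) :
    exCoeff K (0, 0) le_rfl e = 0 := by
  refine (Submodule.span_le (p := LinearMap.ker (exCoeff K (x := x) (0, 0) le_rfl))).2 ?_ he
  rintro _ ⟨p, hp, rfl⟩
  rw [SetLike.mem_coe, LinearMap.mem_ker, exCoeff_mk, AddMonoidAlgebra.coeff_single,
    Finsupp.single_apply, if_neg hp]

theorem mk_single_eq_zero {x : P} {p : EIdx P n y x} (hp : ∃ w, 0 < p.2 w) :
    (Submodule.Quotient.mk (AddMonoidAlgebra.single p 1) : ExMod K P n y x) = 0 :=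
  (Submodule.Quotient.mk_eq_zero _).2 (Submodule.subset_span ⟨p, hp, rfl⟩)

theorem span_emono (x : P) :
    Submodule.span K (Set.range fun q : (BelowIx P n y x →₀ ℤ) × (Pmx P n y x →₀ ℕ) =>
      emono K P n y x q.1 q.2) = ⊤ := by
  rw [eq_top_iff]
  rintro e -
  obtain ⟨g, rfl⟩ := Submodule.Quotient.mk_surjective _ e
  induction g using AddMonoidAlgebra.induction_linear with
  | zero => exact Submodule.zero_mem _
  | add g g' hg hg' => exact Submodule.add_mem _ hg hg'
  | single p r =>
    have : (AddMonoidAlgebra.single p r : Gx K P n y x) = r • AddMonoidAlgebra.single p 1 := by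
      simp
    rw [this, Submodule.Quotient.mk_smul]
    refine Submodule.smul_mem _ _ ?_
    by_cases hp : ∃ w, 0 < p.2 w
    · rw [mk_single_eq_zero K hp]
      exact Submodule.zero_mem _
    · push Not at hp
      refine Submodule.subset_span ⟨(p.1, p.2.mapRange (fun c => (-c).toNat) rfl), ?_⟩
      have hq : mIdx P n y x p.1 (p.2.mapRange (fun c => (-c).toNat) rfl) = p := by
        refine Prod.ext rfl (Finsupp.ext fun w => ?_)
        have := hp w
        simp only [mIdx, Finsupp.coe_neg, Pi.neg_apply, Finsupp.mapRange_apply]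
        omega
      simp only [emono, hq]

theorem exists_apply_emono_ne_zero {x : P} {M : Type*} [AddCommGroup M] [Module K M]
    (f : ExMod K P n y x →ₗ[K] M) (hf : f ≠ 0) : ∃ a b, f (emono K P n y x a b) ≠ 0 := by
  by_contra! h
  refine hf (LinearMap.ext_on (span_emono K x) ?_)
  rintro _ ⟨q, rfl⟩
  exact h q.1 q.2

theorem gdeg_zero (x : P) : gdeg P n y x (0, 0) = 0 := by
  ext i
  simp [gdeg]

theorem eq_zero_of_gdeg_mIdx_eq_zero {x : P} {a : BelowIx P n y x →₀ ℤ}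
    (h : gdeg P n y x (mIdx P n y x a 0) = 0) : a = 0 := by
  ext i
  have := congrFun h i.1
  simpa [gdeg, mIdx, i.2] using this

/-- A clean map sends every basis monomial other than `1_x` into the span of the basis
monomials other than `1_z`. -/
theorem IsClean.eq_zero_of_notMem {x z : P} {ψ : ExMod K P n y x →ₗ[FaceS K P] ExMod K P n y z}
    (hψ : IsClean K P n y x z ψ) {a : BelowIx P n y x →₀ ℤ} {b : Pmx P n y x →₀ ℕ}
    (h : ψ (emono K P n y x a b) ∉ Submodule.span K {e : ExMod K P n y z | ∃ p : EIdx P n y z,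
      p ≠ (0, 0) ∧ e = Submodule.Quotient.mk (AddMonoidAlgebra.single p 1)}) :
    a = 0 ∧ b = 0 := by
  have hdeg : gdeg P n y x (mIdx P n y x a b) = 0 := by
    by_contra hne
    refine h (Submodule.span_mono ?_
      (hψ.1 _ (emono K P n y x a b) (Submodule.subset_span ⟨_, rfl, rfl⟩)))
    rintro _ ⟨p, hp, rfl⟩
    refine ⟨p, ?_, rfl⟩
    rintro rfl
    exact hne (hp ▸ gdeg_zero z)
  obtain rfl : b = 0 := by
    by_contra hb
    refine h (Submodule.span_mono ?_ (hψ.2 (emono K P n y x a b)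
      (Submodule.subset_span ⟨a, b, hb, fun i => (congrFun hdeg i).ge, rfl⟩)))
    rintro _ ⟨a', b', hb', -, rfl⟩
    refine ⟨_, fun he => hb' (Finsupp.ext fun w => ?_), rfl⟩
    have := DFunLike.congr_fun (congrArg Prod.snd he) w
    simpa [mIdx] using this
  exact ⟨eq_zero_of_gdeg_mIdx_eq_zero hdeg, rfl⟩

/-- If there is a nonzero homomorphism `*E_x → *E_z`, every atom below `z` is below `x`. -/
theorem atom_le_of_hom_ne_zero (hy : AtomEnum P n y) {x z : P}
    {ψ : ExMod K P n y x →ₗ[FaceS K P] ExMod K P n y z} (hne : ψ ≠ 0) {i : Fin n}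
    (hi : y i ≤ z) : y i ≤ x := by
  by_contra hx
  obtain ⟨a, b, hab⟩ := exists_apply_emono_ne_zero K (ψ.restrictScalars K) fun h =>
    hne (LinearMap.ext fun e => LinearMap.congr_fun h e)
  obtain ⟨w, hw⟩ := exists_theta_tvar_of_not_le K hy hx
  obtain ⟨p, hp, hc⟩ := exists_exCoeff_ne_zero K hab
  have hkill : tvar K P (y i) ^ (b w + 1) • emono K P n y x a b = 0 := by
    rw [emono, ← Submodule.Quotient.mk_smul, gx_smul_def, map_pow, hw,
      AddMonoidAlgebra.single_pow, AddMonoidAlgebra.single_mul_single, one_pow, one_mul]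
    refine mk_single_eq_zero K ⟨w, ?_⟩
    simp [mIdx]
  have hθ : theta K P n y z (tvar K P (y i) ^ (b w + 1)) =
      AddMonoidAlgebra.single ((b w + 1) • (Finsupp.single ⟨i, hi⟩ 1, 0)) 1 := by
    rw [map_pow, theta_tvar_of_le K hy hi, AddMonoidAlgebra.single_pow, one_pow]
  apply hc
  have hs := exCoeff_smul K hθ (p + (b w + 1) • (Finsupp.single ⟨i, hi⟩ 1, 0))
    (by simpa using hp) (by simpa using hp) (ψ (emono K P n y x a b))
  rw [← map_smul, hkill, map_zero, map_zero] at hs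
  simp only [add_sub_cancel_right] at hs
  exact hs.symm

/-- A nonzero homomorphism `*E_x → *E_z` attains a value with nonzero coefficient at `1_z`. -/
theorem exists_exCoeff_hom_ne_zero (hy : AtomEnum P n y) {x z : P}
    {ψ : ExMod K P n y x →ₗ[FaceS K P] ExMod K P n y z} (hne : ψ ≠ 0) :
    ∃ e, exCoeff K (0, 0) le_rfl (ψ e) ≠ 0 := by
  obtain ⟨e, he⟩ : ∃ e, ψ e ≠ 0 := by
    by_contra! h
    exact hne (LinearMap.ext h)
  obtain ⟨⟨a, c⟩, hp, hc⟩ := exists_exCoeff_ne_zero K he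
  set a₁ : BelowIx P n y z →₀ ℕ := a.mapRange Int.toNat rfl
  set a₂ : BelowIx P n y z →₀ ℕ := a.mapRange (fun k => (-k).toNat) rfl
  have ha : a = a₁.mapRange (Nat.cast : ℕ → ℤ) Nat.cast_zero -
      a₂.mapRange (Nat.cast : ℕ → ℤ) Nat.cast_zero := by
    ext i
    simp only [a₁, a₂, Finsupp.coe_sub, Pi.sub_apply, Finsupp.mapRange_apply]
    omega
  set b : Pmx P n y z →₀ ℕ := c.mapRange (fun k => (-k).toNat) rfl
  have hb : c = -b.mapRange (Nat.cast : ℕ → ℤ) Nat.cast_zero := by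
    ext w
    have : c w ≤ 0 := hp w
    simp only [b, Finsupp.coe_neg, Pi.neg_apply, Finsupp.mapRange_apply]
    omega
  obtain ⟨e', rfl⟩ : ∃ e', atomMon K a₁ • e' = e := by
    obtain ⟨g, rfl⟩ := Submodule.Quotient.mk_surjective _ e
    obtain ⟨u, hu⟩ := isUnit_theta_atomMon K hy
      (fun i hi => atom_le_of_hom_ne_zero K hy hne hi) a₁
    refine ⟨Submodule.Quotient.mk (↑u⁻¹ * g), ?_⟩
    rw [← Submodule.Quotient.mk_smul, gx_smul_def, ← hu, Units.mul_inv_cancel_left]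
  obtain ⟨s, hs⟩ := exists_theta_eq_single K hy b
  have hs' : theta K P n y z (atomMon K a₂ * s) = AddMonoidAlgebra.single
      (a₂.mapRange (Nat.cast : ℕ → ℤ) Nat.cast_zero,
        b.mapRange (Nat.cast : ℕ → ℤ) Nat.cast_zero) 1 := by
    rw [map_mul, theta_atomMon K hy, hs, AddMonoidAlgebra.single_mul_single]
    simp
  refine ⟨(atomMon K a₂ * s) • e', ?_⟩
  rw [map_smul, exCoeff_smul K (theta_atomMon K hy a₁) _ _ (by simpa using hp)] at hc
  rw [map_smul, exCoeff_smul K hs' _ _ (by simpa [hb] using hp)]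
  convert hc using 3
  simp [ha, hb]

end Helpers

/-- Lemma 3.8: for a nonzero clean map `ψ : *E_x → *E_z` and a
basis monomial `α` of `*E_x`, the coefficient `[ψ(α) : 1_z]` of `1_z` in `ψ(α)` is
nonzero iff `α = 1_x`.  (The coefficient of the basis vector `1_z` is nonzero iff
the element does not lie in the span of the remaining basis monomials.) -/
theorem statement16
    (hP : IsSimplicialPoset P) (hy : AtomEnum P n y) (x z : P)
    (ψ : ExMod K P n y x →ₗ[FaceS K P] ExMod K P n y z)
    (hclean : IsClean K P n y x z ψ) (hne : ψ ≠ 0)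
    (a : BelowIx P n y x →₀ ℤ) (b : Pmx P n y x →₀ ℕ) :
    ψ (emono K P n y x a b) ∉
        Submodule.span K
          {e : ExMod K P n y z | ∃ p : EIdx P n y z,
            p ≠ (0, 0) ∧ e = Submodule.Quotient.mk (AddMonoidAlgebra.single p 1)} ↔
      emono K P n y x a b = onex K P n y x := by
  refine ⟨fun h => ?_, fun h hmem => ?_⟩
  · obtain ⟨rfl, rfl⟩ := hclean.eq_zero_of_notMem K h
    rfl
  · rw [h] at hmem
    obtain ⟨e, he⟩ := exists_exCoeff_hom_ne_zero K hy hne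
    obtain ⟨a', b', hab⟩ := exists_apply_emono_ne_zero K
      (exCoeff K (0, 0) le_rfl ∘ₗ ψ.restrictScalars K) fun h0 => he (LinearMap.congr_fun h0 e)
    obtain ⟨rfl, rfl⟩ := hclean.eq_zero_of_notMem K fun hm =>
      hab (exCoeff_eq_zero_of_mem_span K hm)
    exact hab (exCoeff_eq_zero_of_mem_span K hmem)

end
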